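/- Let (X,d) be a compact metric space, T : X → X a continuous map, f : X → ℝ continuous, and fix a family {N_δ : δ > 0} ⊂ ℕ with N_δ ≥ 1 for all δ. Then P(X,T,f) ≤ PFKPO(X,T,f); that is, the classical topological pressure is bounded above by the topological pressure with respect to Feldman-Katok pseudo-orbits. -/

import Mathlib

open Filter Metric Set Topology

variable {X : Type*}

def FKChain [MetricSpace X] (T : X → X) (α δ : ℝ) (n : ℕ) (x : ℕ → X) : Prop :=
  ∃ k : ℕ, (1 - δ) * (n : ℝ) < (k : ℝ) ∧ k ≤ n ∧
    ∃ i j : ℕ → ℕ,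
      StrictMonoOn i (Set.Iio k) ∧ StrictMonoOn j (Set.Iio k) ∧
      (∀ t < k, i t < n ∧ j t < n) ∧
      (∀ t, t + 1 < k → dist (T^[j (t + 1) - j t] (x (i t))) (x (i (t + 1))) ≤ α)

def FKPO [MetricSpace X] (T : X → X) (α δ : ℝ) (N : ℕ) : Set (ℕ → X) :=
  { x | ∃ s : ℕ → ℕ, StrictMono s ∧ s 0 ≤ N ∧ (∀ i, s (i + 1) - s i ≤ N) ∧
      ∀ m n : ℕ, n < m → FKChain T α δ (s m - s n) (fun t => x (s n + t)) }

noncomputable def FKPOsp [MetricSpace X] (T : X → X) (f : X → ℝ) (n : ℕ) (ε α δ : ℝ)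
    (N : ℕ) : ℝ :=
  sInf { r : ℝ | ∃ F : Finset (ℕ → X), ↑F ⊆ FKPO T α δ N ∧
      (∀ x ∈ FKPO T α δ N, ∃ y ∈ F, ∀ i < n, dist (x i) (y i) < ε) ∧
      r = ∑ y ∈ F, Real.exp (∑ i ∈ Finset.range n, f (y i)) }

noncomputable def PFKPO [MetricSpace X] (T : X → X) (f : X → ℝ) (N : ℝ → ℕ) : ℝ :=
  limsup (fun ε : ℝ =>
      limsup (fun δ : ℝ =>
          sInf { r : ℝ | ∃ α : ℝ, 0 < α ∧
              r = limsup (fun n : ℕ => Real.log (FKPOsp T f n ε α δ (N δ)) / n) atTop })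
        (nhdsWithin 0 (Set.Ioi 0)))
    (nhdsWithin 0 (Set.Ioi 0))

noncomputable def spanPress [MetricSpace X] (T : X → X) (f : X → ℝ) (n : ℕ) (ε : ℝ) : ℝ :=
  sInf { r : ℝ | ∃ F : Finset X,
      (∀ x : X, ∃ y ∈ F, ∀ i < n, dist (T^[i] x) (T^[i] y) ≤ ε) ∧
      r = ∑ y ∈ F, Real.exp (∑ i ∈ Finset.range n, f (T^[i] y)) }

noncomputable def Pres [MetricSpace X] (T : X → X) (f : X → ℝ) : ℝ :=
  limsup (fun ε : ℝ => limsup (fun n : ℕ => Real.log (spanPress T f n ε) / n) atTop)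
    (nhdsWithin 0 (Set.Ioi 0))

theorem exists_finset_spanning_of_code [MetricSpace X] {Y : Set (ℕ → X)} {ι : Type*} [Fintype ι]
    {n : ℕ} {ε : ℝ} (R : (ℕ → X) → ι → Prop) (hR : ∀ x ∈ Y, ∃ c, R x c)
    (hc : ∀ x ∈ Y, ∀ y ∈ Y, ∀ c, R x c → R y c → ∀ i < n, dist (x i) (y i) < ε) :
    ∃ F : Finset (ℕ → X), ↑F ⊆ Y ∧ (∀ x ∈ Y, ∃ y ∈ F, ∀ i < n, dist (x i) (y i) < ε) ∧
      F.card ≤ Fintype.card ι := by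
  classical
  rcases isEmpty_or_nonempty ι with hι | hι
  · exact ⟨∅, by simp, fun x hx => (hι.false (hR x hx).choose).elim, by simp⟩
  choose! code hcode using hR
  obtain ⟨Y', hY', hbij⟩ := (surjOn_image code Y).exists_bijOn_subset
  have hfin : Y'.Finite := Set.Finite.of_finite_image (Set.toFinite _) hbij.injOn
  refine ⟨hfin.toFinset, by simpa using hY', fun x hx => ?_, ?_⟩
  · obtain ⟨y, hy, hxy⟩ := hbij.surjOn (mem_image_of_mem code hx)
    refine ⟨y, by simpa using hy, hc x hx y (hY' hy) (code x) (hcode x hx) ?_⟩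
    rw [← hxy]
    exact hcode y (hY' hy)
  · refine Finset.card_le_card_of_injOn code (t := Finset.univ) (fun _ _ => Finset.mem_univ _) ?_
    simpa using hbij.injOn

theorem exists_finset_dist_lt [MetricSpace X] [CompactSpace X] {ε : ℝ} (hε : 0 < ε) :
    ∃ t : Finset X, ∀ x : X, ∃ y ∈ t, dist x y < ε := by
  obtain ⟨t, -, ht, hcov⟩ := (isCompact_univ (X := X)).finite_cover_balls hε
  refine ⟨ht.toFinset, fun x => ?_⟩
  obtain ⟨y, hy, hxy⟩ := mem_iUnion₂.1 (hcov (mem_univ x))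
  exact ⟨y, by simpa using hy, hxy⟩

theorem orbit_mem_FKPO [MetricSpace X] (T : X → X) {α δ : ℝ} (hα : 0 < α) (hδ : 0 < δ)
    {N : ℕ} (hN : 1 ≤ N) (x : X) : (fun i => T^[i] x) ∈ FKPO T α δ N := by
  refine ⟨id, strictMono_id, by simp, fun i => by simpa using hN, fun m n hnm => ?_⟩
  have hpos : (0 : ℝ) < ((m - n : ℕ) : ℝ) := by
    exact_mod_cast Nat.sub_pos_of_lt hnm
  refine ⟨m - n, ?_, le_rfl, id, id, strictMono_id.strictMonoOn _, strictMono_id.strictMonoOn _,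
    fun t ht => ⟨ht, ht⟩, fun t _ => ?_⟩
  · simp only [id]
    nlinarith
  · have : T^[1] (T^[n + t] x) = T^[n + (t + 1)] x := by
      rw [← Function.iterate_add_apply]
      congr 1
      ring_nf
    simp only [id, Nat.add_sub_cancel_left, this, dist_self]
    exact hα.le

theorem exists_pseudoOrbit_of_matching [MetricSpace X] (T : X → X) {α : ℝ} (hα : 0 ≤ α) {k : ℕ}
    {j : ℕ → ℕ} (hj : StrictMonoOn j (Set.Iio k)) (hj0 : j 0 = 0) (u : ℕ → X)
    (hu : ∀ t, t + 1 < k → dist (T^[j (t + 1) - j t] (u t)) (u (t + 1)) ≤ α) :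
    ∃ y : ℕ → X, (∀ q, dist (T (y q)) (y (q + 1)) ≤ α) ∧ ∀ t < k, y (j t) = u t := by
  classical
  let g : ℕ → ℕ := fun q => Nat.findGreatest (fun t => t < k ∧ j t ≤ q) k
  have hg1 : ∀ q, j (g q) ≤ q := by
    intro q
    by_cases h : g q = 0
    · rw [h, hj0]; exact Nat.zero_le q
    · exact (Nat.findGreatest_of_ne_zero (P := fun t => t < k ∧ j t ≤ q) (n := k) rfl h).2
  have hg2 : ∀ q t, t < k → j t ≤ q → t ≤ g q := fun q t ht h =>
    Nat.le_findGreatest (P := fun t => t < k ∧ j t ≤ q) ht.le ⟨ht, h⟩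
  have hg3 : ∀ q, g q ≠ 0 → g q < k := fun q h =>
    (Nat.findGreatest_of_ne_zero (P := fun t => t < k ∧ j t ≤ q) (n := k) rfl h).1
  refine ⟨fun q => T^[q - j (g q)] (u (g q)), fun q => ?_, fun t ht => ?_⟩
  · have hle : g q ≤ g (q + 1) := by
      by_cases h : g q = 0
      · rw [h]; exact Nat.zero_le _
      · exact hg2 _ _ (hg3 q h) ((hg1 q).trans (Nat.le_succ q))
    have hstep : T (T^[q - j (g q)] (u (g q))) = T^[q + 1 - j (g q)] (u (g q)) := by
      rw [← Function.iterate_succ_apply' T, Nat.succ_eq_add_one, Nat.sub_add_comm (hg1 q)]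
    simp only [hstep]
    rcases hle.eq_or_lt with h | h
    · rw [← h, dist_self]; exact hα
    · have hk' : g (q + 1) < k := hg3 _ (by omega)
      have hk : g q + 1 < k := by omega
      have h1 : q < j (g q + 1) := by
        by_contra! hcon
        have := hg2 q _ hk hcon
        omega
      have h2 : j (g q + 1) ≤ j (g (q + 1)) :=
        (hj.le_iff_le (mem_Iio.2 hk) (mem_Iio.2 hk')).2 h
      have h3 := hg1 (q + 1)
      have h4 : j (g q + 1) = q + 1 := by omega
      have h5 : g (q + 1) = g q + 1 :=
        hj.injOn (mem_Iio.2 hk') (mem_Iio.2 hk) (by omega)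
      have := hu (g q) hk
      rw [h4] at this
      simpa [h5, h4] using this
  · have h1 : t ≤ g (j t) := hg2 _ _ ht le_rfl
    have h2 : g (j t) = t := by
      by_cases h : g (j t) = 0
      · omega
      · exact le_antisymm
          ((hj.le_iff_le (mem_Iio.2 (hg3 _ h)) (mem_Iio.2 ht)).1 (hg1 _)) h1
    simp [h2]

theorem exists_shadow_const [MetricSpace X] [CompactSpace X] {T : X → X} (hT : Continuous T)
    (M : ℕ) {ε : ℝ} (hε : 0 < ε) :
    ∃ α : ℝ, 0 < α ∧ ∀ y : ℕ → X, (∀ q, dist (T (y q)) (y (q + 1)) ≤ α) →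
      ∀ r ≤ M, dist (T^[r] (y 0)) (y r) ≤ ε := by
  induction M generalizing ε with
  | zero => exact ⟨1, one_pos, fun y _ r hr => by simp [Nat.le_zero.1 hr, hε.le]⟩
  | succ M ih =>
    obtain ⟨η, hη, hTη⟩ := Metric.uniformContinuous_iff.1
      (CompactSpace.uniformContinuous_of_continuous hT) (ε / 2) (half_pos hε)
    obtain ⟨α, hα, h⟩ := ih (ε := min ε (η / 2)) (by positivity)
    refine ⟨min α (ε / 2), by positivity, fun y hy r hr => ?_⟩
    have h' := h y (fun q => (hy q).trans (min_le_left _ _))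
    rcases Nat.le_succ_iff.1 hr with hr | rfl
    · exact (h' r hr).trans (min_le_left _ _)
    · have h1 := (h' M le_rfl).trans (min_le_right _ _)
      have h2 := hTη (show dist (T^[M] (y 0)) (y M) < η by linarith)
      have h3 := (hy M).trans (min_le_right _ _)
      rw [Nat.succ_eq_add_one, Function.iterate_succ_apply']
      linarith [dist_triangle (T (T^[M] (y 0))) (T (y M)) (y (M + 1))]

theorem StrictMonoOn.eqOn_Iio_of_image_range_eq {k k' : ℕ} {i i' : ℕ → ℕ}
    (hi : StrictMonoOn i (Set.Iio k)) (hi' : StrictMonoOn i' (Set.Iio k'))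
    (h : (Finset.range k).image i = (Finset.range k').image i') :
    k = k' ∧ ∀ t < k, i t = i' t := by
  have hcard : ∀ {k : ℕ} {i : ℕ → ℕ}, StrictMonoOn i (Set.Iio k) →
      ((Finset.range k).image i).card = k := by
    intro k i hi
    rw [Finset.card_image_of_injOn (by simpa using hi.injOn), Finset.card_range]
  have hk : k = k' := by rw [← hcard hi, h, hcard hi']
  subst hk
  refine ⟨rfl, fun t ht => ?_⟩
  have h1 := Finset.orderEmbOfFin_unique (hcard hi) (f := fun a : Fin k => i a)
    (fun a => Finset.mem_image_of_mem i (Finset.mem_range.2 a.2))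
    (fun a b hab => hi a.2 b.2 hab)
  have h2 := Finset.orderEmbOfFin_unique (hcard hi) (f := fun a : Fin k => i' a)
    (fun a => by rw [h]; exact Finset.mem_image_of_mem i' (Finset.mem_range.2 a.2))
    (fun a b hab => hi' a.2 b.2 hab)
  exact congrFun (h1.trans h2.symm) ⟨t, ht⟩

/-- A finite code for an initial segment of a Feldman-Katok pseudo-orbit `x`: the offset `a`, the
sets `I` and `J` of matched indices, the approximate values `w` at the unmatched places, and the
points `z` whose orbits follow, in blocks of length `M`, a pseudo-orbit interpolating the matched
values. -/
def FKCode [MetricSpace X] (T : X → X) (ε : ℝ) (n M a : ℕ) (I J : Finset ℕ) {K B : ℕ}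
    {t F : Finset X} (w : Fin K → t) (z : Fin B → F) (x : ℕ → X) : Prop :=
  (∃ (k : ℕ) (i j : ℕ → ℕ) (y : ℕ → X), StrictMonoOn i (Set.Iio k) ∧
    StrictMonoOn j (Set.Iio k) ∧ (Finset.range k).image i = I ∧ (Finset.range k).image j = J ∧
    (∀ t < k, j t / M < B) ∧ (∀ t < k, x (a + i t) = y (j t)) ∧
    ∀ b : Fin B, ∀ r < M, dist (y (b * M + r)) (T^[r] (z b)) ≤ 2 * ε) ∧
  ∀ p < n, p ∉ I.image (a + ·) →
    ∃ v : Fin K, (v : ℕ) = ((Finset.range p).filter (· ∉ I.image (a + ·))).card ∧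
      dist (x p) (w v) < ε

theorem FKCode.dist_lt [MetricSpace X] {T : X → X} {ε : ℝ} (hε : 0 < ε) {n M a : ℕ}
    (hM : 0 < M) {I J : Finset ℕ} {K B : ℕ} {t F : Finset X} {w : Fin K → t} {z : Fin B → F}
    {x x' : ℕ → X} (hx : FKCode T ε n M a I J w z x) (hx' : FKCode T ε n M a I J w z x')
    {p : ℕ} (hp : p < n) : dist (x p) (x' p) < 5 * ε := by
  obtain ⟨⟨k, i, j, y, hi, hj, hI, hJ, hB, hxy, hyz⟩, hw⟩ := hx
  obtain ⟨⟨k', i', j', y', hi', hj', hI', hJ', -, hxy', hyz'⟩, hw'⟩ := hx'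
  by_cases h : p ∈ I.image (a + ·)
  · obtain ⟨rfl, hii⟩ := hi.eqOn_Iio_of_image_range_eq hi' (hI.trans hI'.symm)
    obtain ⟨-, hjj⟩ := hj.eqOn_Iio_of_image_range_eq hj' (hJ.trans hJ'.symm)
    rw [← hI] at h
    simp only [Finset.mem_image, Finset.mem_range] at h
    obtain ⟨_, ⟨t, ht, rfl⟩, rfl⟩ := h
    have h1 := hyz ⟨_, hB t ht⟩ (j t % M) (Nat.mod_lt _ hM)
    have h2 := hyz' ⟨_, hB t ht⟩ (j t % M) (Nat.mod_lt _ hM)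
    simp only [Nat.div_add_mod'] at h1 h2
    have h3 := hxy' t ht
    rw [← hii t ht, ← hjj t ht] at h3
    rw [hxy t ht, h3]
    linarith [dist_triangle_right (y (j t)) (y' (j t))
      (T^[j t % M] (z ⟨j t / M, hB t ht⟩ : X))]
  · obtain ⟨v, hv, hd⟩ := hw p hp h
    obtain ⟨v', hv', hd'⟩ := hw' p hp h
    obtain rfl : v = v' := Fin.ext (hv.trans hv'.symm)
    linarith [dist_triangle_right (x p) (x' p) (w v)]

theorem exists_code_of_mem_FKPO [MetricSpace X] {T : X → X} {ε α δ : ℝ} {N n M : ℕ}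
    (hα : 0 ≤ α) (hδ : 0 ≤ δ) (hn : N < n) {t F : Finset X}
    (ht : ∀ x : X, ∃ y ∈ t, dist x y < ε)
    (hF : ∀ x : X, ∃ y ∈ F, ∀ i < M, dist (T^[i] x) (T^[i] y) ≤ ε)
    (hshadow : ∀ y : ℕ → X, (∀ q, dist (T (y q)) (y (q + 1)) ≤ α) →
      ∀ r ≤ M, dist (T^[r] (y 0)) (y r) ≤ ε)
    {x : ℕ → X} (hx : x ∈ FKPO T α δ N) :
    ∃ a ≤ N, ∃ I ⊆ Finset.range (n + N), ∃ J ⊆ Finset.range (n + N),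
      ∃ (w : Fin (N + ⌊δ * (n + N : ℕ)⌋₊ + 1) → t) (z : Fin ((n + N) / M + 1) → F),
        FKCode T ε n M a I J w z x := by
  classical
  obtain ⟨s, hs, hs0, hsN, hchain⟩ := hx
  have hex : ∃ m, n ≤ s m := ⟨n, hs.le_apply⟩
  obtain ⟨m, hm, hmN⟩ : ∃ m, n ≤ s (m + 1) ∧ s (m + 1) < n + N := by
    have h0 : Nat.find hex ≠ 0 := fun h => by
      have := Nat.find_spec hex
      rw [h] at this
      omega
    obtain ⟨m, hm⟩ := Nat.exists_eq_succ_of_ne_zero h0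
    refine ⟨m, ?_, ?_⟩
    · have := Nat.find_spec hex
      rwa [hm] at this
    · have h1 := Nat.find_min hex (m := m) (by omega)
      have h2 := hsN m
      omega
  obtain ⟨k, hk1, hk2, i, j, hi, hj, hij, hd⟩ := hchain (m + 1) 0 (Nat.succ_pos m)
  set L := s (m + 1) - s 0 with hL
  have hj0 : ∀ t < k, j 0 ≤ j t := fun t ht =>
    (hj.le_iff_le (mem_Iio.2 (by omega)) (mem_Iio.2 ht)).2 (Nat.zero_le t)
  have hj' : StrictMonoOn (fun t => j t - j 0) (Set.Iio k) := fun p hp q hq hpq => by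
    have h1 := hj hp hq hpq
    have h2 := hj0 p hp
    show j p - j 0 < j q - j 0
    omega
  obtain ⟨y, hy, hyx⟩ := exists_pseudoOrbit_of_matching T hα hj' (Nat.sub_self _)
    (fun t => x (s 0 + i t)) (fun t ht => by
      have h1 := hj0 t (by omega)
      have h2 := hj0 (t + 1) ht
      have h3 : j (t + 1) - j 0 - (j t - j 0) = j (t + 1) - j t := by omega
      simpa only [h3] using hd t ht)
  set I := (Finset.range k).image i with hI
  have hIL : I ⊆ Finset.range L := by
    intro p hp
    obtain ⟨t, ht, rfl⟩ := Finset.mem_image.1 hp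
    exact Finset.mem_range.2 (hij t (Finset.mem_range.1 ht)).1
  have hLn : L ≤ n + N := by omega
  choose near hnear hdist using ht
  choose sp hsp hspd using hF
  refine ⟨s 0, hs0, I, hIL.trans (Finset.range_mono hLn),
    (Finset.range k).image (fun t => j t - j 0), ?_,
    fun v => ⟨near (x (Nat.nth (fun p => p ∉ I.image (s 0 + ·)) v)), hnear _⟩,
    fun b => ⟨sp (y (b * M)), hsp _⟩, ⟨k, i, _, y, hi, hj', rfl, rfl, ?_, ?_, ?_⟩, ?_⟩
  · intro p hp
    obtain ⟨t, ht, rfl⟩ := Finset.mem_image.1 hp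
    have := (hij t (Finset.mem_range.1 ht)).2
    rw [Finset.mem_range]
    omega
  · intro t ht
    have := (hij t ht).2
    exact Nat.lt_succ_of_le (Nat.div_le_div_right (show j t - j 0 ≤ n + N by omega))
  · exact fun t ht => (hyx t ht).symm
  · intro b r hr
    have h1 := hshadow (fun q => y (b * M + q)) (fun q => hy _) r hr.le
    have h2 := hspd (y (b * M)) r hr
    rw [dist_comm] at h1
    simp only [Nat.add_zero] at h1
    linarith [dist_triangle (y (b * M + r)) (T^[r] (y (b * M))) (T^[r] (sp (y (b * M))))]
  · intro p hp hpI
    have hcount : Nat.count (fun q => q ∉ I.image (s 0 + ·)) p <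
        N + ⌊δ * (n + N : ℕ)⌋₊ + 1 := by
      have hkL : L - k ≤ ⌊δ * (n + N : ℕ)⌋₊ := by
        refine Nat.le_floor ?_
        rw [Nat.cast_sub hk2]
        have : δ * (L : ℝ) ≤ δ * (n + N : ℕ) := by gcongr
        linarith
      have hIk : (Finset.range L \ I).card = L - k := by
        rw [Finset.card_sdiff_of_subset hIL, Finset.card_range, hI,
          Finset.card_image_of_injOn (by simpa using hi.injOn), Finset.card_range]
      have hsub : (Finset.range p).filter (fun q => q ∉ I.image (s 0 + ·)) ⊆
          Finset.range (s 0) ∪ (Finset.range L \ I).image (s 0 + ·) := by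
        intro q hq
        simp only [Finset.mem_filter, Finset.mem_range, Finset.mem_image, Finset.mem_union,
          Finset.mem_sdiff, not_exists, not_and] at hq ⊢
        by_cases hqs : q < s 0
        · exact Or.inl hqs
        · refine Or.inr ⟨q - s 0, ⟨by omega, fun h => hq.2 _ h (by omega)⟩, by omega⟩
      rw [Nat.count_eq_card_filter_range]
      have h1 := Finset.card_le_card hsub
      have h2 := Finset.card_union_le (Finset.range (s 0))
        ((Finset.range L \ I).image (s 0 + ·))
      have h3 := Finset.card_image_le (s := Finset.range L \ I) (f := (s 0 + ·))
      rw [Finset.card_range] at h2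
      omega
    refine ⟨⟨_, hcount⟩, Nat.count_eq_card_filter_range _ _, ?_⟩
    have hnth := Nat.nth_count (p := fun q => q ∉ I.image (s 0 + ·)) hpI
    simpa only [hnth] using hdist (x p)

theorem exists_finset_spanning_FKPO_card_le [MetricSpace X] {T : X → X} {ε α δ : ℝ} {N n M : ℕ}
    (hε : 0 < ε) (hα : 0 ≤ α) (hδ : 0 ≤ δ) (hM : 0 < M) (hn : N < n) {t F : Finset X}
    (ht : ∀ x : X, ∃ y ∈ t, dist x y < ε)
    (hF : ∀ x : X, ∃ y ∈ F, ∀ i < M, dist (T^[i] x) (T^[i] y) ≤ ε)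
    (hshadow : ∀ y : ℕ → X, (∀ q, dist (T (y q)) (y (q + 1)) ≤ α) →
      ∀ r ≤ M, dist (T^[r] (y 0)) (y r) ≤ ε) :
    ∃ G : Finset (ℕ → X), ↑G ⊆ FKPO T α δ N ∧
      (∀ x ∈ FKPO T α δ N, ∃ y ∈ G, ∀ i < n, dist (x i) (y i) < 5 * ε) ∧
      G.card ≤ (N + 1) * (2 ^ (n + N) * (2 ^ (n + N) *
        (t.card ^ (N + ⌊δ * (n + N : ℕ)⌋₊ + 1) * F.card ^ ((n + N) / M + 1)))) := by
  obtain ⟨G, hG1, hG2, hG3⟩ := exists_finset_spanning_of_code (Y := FKPO T α δ N) (n := n)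
    (ε := 5 * ε)
    (ι := Fin (N + 1) × (Finset.range (n + N)).powerset × (Finset.range (n + N)).powerset ×
      (Fin (N + ⌊δ * (n + N : ℕ)⌋₊ + 1) → t) × (Fin ((n + N) / M + 1) → F))
    (fun x c => FKCode T ε n M c.1 c.2.1 c.2.2.1 c.2.2.2.1 c.2.2.2.2 x)
    (fun x hx => by
      obtain ⟨a, ha, I, hI, J, hJ, w, z, h⟩ :=
        exists_code_of_mem_FKPO hα hδ hn ht hF hshadow hx
      exact ⟨⟨⟨a, Nat.lt_succ_of_le ha⟩, ⟨I, Finset.mem_powerset.2 hI⟩,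
        ⟨J, Finset.mem_powerset.2 hJ⟩, w, z⟩, h⟩)
    (fun x _ y _ c hx hy i hi => hx.dist_lt hε hM hy hi)
  refine ⟨G, hG1, hG2, hG3.trans_eq ?_⟩
  simp only [Fintype.card_prod, Fintype.card_fin, Fintype.card_coe, Finset.card_powerset,
    Finset.card_range, Fintype.card_fun]

theorem exists_finset_spanning_card_le_pow [MetricSpace X] {Y : Set (ℕ → X)} {ε : ℝ} (n : ℕ)
    {t : Finset X} (ht : ∀ x : X, ∃ y ∈ t, dist x y < ε) :
    ∃ G : Finset (ℕ → X), ↑G ⊆ Y ∧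
      (∀ x ∈ Y, ∃ y ∈ G, ∀ i < n, dist (x i) (y i) < 2 * ε) ∧ G.card ≤ t.card ^ n := by
  choose near hnear hdist using ht
  obtain ⟨G, hG1, hG2, hG3⟩ := exists_finset_spanning_of_code (Y := Y) (n := n) (ε := 2 * ε)
    (ι := Fin n → t) (fun x c => ∀ i : Fin n, dist (x i) (c i) < ε)
    (fun x _ => ⟨fun i => ⟨near (x i), hnear _⟩, fun i => hdist _⟩)
    (fun x _ y _ c hx hy i hi => by
      linarith [hx ⟨i, hi⟩, hy ⟨i, hi⟩, dist_triangle_right (x i) (y i) (c ⟨i, hi⟩)])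
  exact ⟨G, hG1, hG2, by simpa using hG3⟩

theorem abs_sum_range_le {f : X → ℝ} {A : ℝ} (hA : ∀ x, |f x| ≤ A) (n : ℕ) (u : ℕ → X) :
    |∑ i ∈ Finset.range n, f (u i)| ≤ n * A := by
  refine (Finset.abs_sum_le_sum_abs _ _).trans ?_
  simpa using Finset.sum_le_sum (s := Finset.range n) (fun i _ => hA (u i))

theorem FKPOsp_le_card_mul_exp [MetricSpace X] {T : X → X} {f : X → ℝ} {A : ℝ}
    (hA : ∀ x, |f x| ≤ A) {n N : ℕ} {ε α δ : ℝ} {G : Finset (ℕ → X)}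
    (hG : ↑G ⊆ FKPO T α δ N)
    (hspan : ∀ x ∈ FKPO T α δ N, ∃ y ∈ G, ∀ i < n, dist (x i) (y i) < ε) :
    FKPOsp T f n ε α δ N ≤ G.card * Real.exp (n * A) := by
  have h : FKPOsp T f n ε α δ N ≤ ∑ y ∈ G, Real.exp (∑ i ∈ Finset.range n, f (y i)) := by
    refine csInf_le ⟨0, ?_⟩ ⟨G, hG, hspan, rfl⟩
    rintro r ⟨F, -, -, rfl⟩
    positivity
  refine h.trans ?_
  rw [← nsmul_eq_mul]
  exact Finset.sum_le_card_nsmul _ _ _ fun y _ =>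
    Real.exp_le_exp.2 (abs_le.1 (abs_sum_range_le hA n y)).2

theorem exp_le_sum_exp {ι : Type*} {A : ℝ} {n : ℕ} {F : Finset ι} {S : ι → ℝ}
    (hF : F.Nonempty) (hS : ∀ y, |S y| ≤ n * A) :
    Real.exp (-(n * A)) ≤ ∑ y ∈ F, Real.exp (S y) := by
  obtain ⟨y, hy⟩ := hF
  exact (Real.exp_le_exp.2 (abs_le.1 (hS y)).1).trans
    (Finset.single_le_sum (f := fun y => Real.exp (S y)) (fun _ _ => (Real.exp_pos _).le) hy)

theorem exists_spanning_sum_le [MetricSpace X] {T : X → X} {f : X → ℝ} {ε η α δ : ℝ}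
    (hη : ∀ u v, dist u v < ε → |f u - f v| ≤ η) {n N : ℕ} (hα : 0 < α) (hδ : 0 < δ)
    (hN : 1 ≤ N) {G : Finset (ℕ → X)}
    (hspan : ∀ x ∈ FKPO T α δ N, ∃ y ∈ G, ∀ i < n, dist (x i) (y i) < ε) :
    ∃ F : Finset X, (∀ x : X, ∃ y ∈ F, ∀ i < n, dist (T^[i] x) (T^[i] y) ≤ 2 * ε) ∧
      ∑ y ∈ F, Real.exp (∑ i ∈ Finset.range n, f (T^[i] y)) ≤
        Real.exp (n * η) * ∑ y ∈ G, Real.exp (∑ i ∈ Finset.range n, f (y i)) := by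
  classical
  rcases isEmpty_or_nonempty X with hX | hX
  · exact ⟨∅, fun x => (hX.false x).elim, by rw [Finset.sum_empty]; positivity⟩
  let P : (ℕ → X) → Prop := fun y => ∃ x : X, ∀ i < n, dist (T^[i] x) (y i) < ε
  have hP : ∀ y, P y → ∃ x : X, ∀ i < n, dist (T^[i] x) (y i) < ε := fun y hy => hy
  choose! g hg using hP
  refine ⟨(G.filter P).image g, fun x => ?_, ?_⟩
  · obtain ⟨y, hy, hxy⟩ := hspan _ (orbit_mem_FKPO T hα hδ hN x)
    have hPy : P y := ⟨x, hxy⟩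
    refine ⟨g y, Finset.mem_image_of_mem _ (Finset.mem_filter.2 ⟨hy, hPy⟩), fun i hi => ?_⟩
    linarith [hxy i hi, hg y hPy i hi, dist_triangle_right (T^[i] x) (T^[i] (g y)) (y i)]
  · rw [Finset.mul_sum]
    calc _ ≤ ∑ y ∈ G.filter P, Real.exp (∑ i ∈ Finset.range n, f (T^[i] (g y))) :=
          Finset.sum_image_le_of_nonneg
            (f := fun x => Real.exp (∑ i ∈ Finset.range n, f (T^[i] x)))
            (fun _ _ => (Real.exp_pos _).le)
      _ ≤ ∑ y ∈ G.filter P, Real.exp (n * η) * Real.exp (∑ i ∈ Finset.range n, f (y i)) := by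
          refine Finset.sum_le_sum fun y hy => ?_
          rw [← Real.exp_add, Real.exp_le_exp, ← sub_le_iff_le_add, ← Finset.sum_sub_distrib]
          refine (Finset.sum_le_card_nsmul _ _ η fun i hi => ?_).trans_eq (by simp)
          exact (le_abs_self _).trans
            (hη _ _ (hg y (Finset.mem_filter.1 hy).2 i (Finset.mem_range.1 hi)))
      _ ≤ _ := Finset.sum_le_sum_of_subset_of_nonneg (Finset.filter_subset P G)
          fun _ _ _ => by positivity

theorem spanPress_le_mul_FKPOsp [MetricSpace X] [CompactSpace X] {T : X → X} {f : X → ℝ}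
    {ε η α δ : ℝ} (hε : 0 < ε) (hη : ∀ u v, dist u v < ε → |f u - f v| ≤ η) {n N : ℕ}
    (hα : 0 < α) (hδ : 0 < δ) (hN : 1 ≤ N) :
    spanPress T f n (2 * ε) ≤ Real.exp (n * η) * FKPOsp T f n ε α δ N := by
  obtain ⟨t, ht⟩ := exists_finset_dist_lt (X := X) (half_pos hε)
  obtain ⟨G, hG1, hG2, -⟩ := exists_finset_spanning_card_le_pow (Y := FKPO T α δ N) n ht
  rw [mul_div_cancel₀ _ two_ne_zero] at hG2
  rw [mul_comm (Real.exp _), ← div_le_iff₀ (Real.exp_pos _)]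
  refine le_csInf ⟨_, G, hG1, hG2, rfl⟩ ?_
  rintro r ⟨F, -, hF2, rfl⟩
  rw [div_le_iff₀ (Real.exp_pos _), mul_comm _ (Real.exp _)]
  obtain ⟨F', hF', hle⟩ := exists_spanning_sum_le hη hα hδ hN hF2
  refine le_trans ?_ hle
  refine csInf_le ⟨0, ?_⟩ ⟨F', hF', rfl⟩
  rintro r ⟨F, -, rfl⟩
  positivity

theorem exists_finset_spanning [MetricSpace X] [CompactSpace X] (T : X → X) (n : ℕ) {ε : ℝ}
    (hε : 0 < ε) :
    ∃ F : Finset X, ∀ x : X, ∃ y ∈ F, ∀ i < n, dist (T^[i] x) (T^[i] y) ≤ ε := by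
  obtain ⟨t, ht⟩ := exists_finset_dist_lt (X := X) (show 0 < ε / 4 by positivity)
  obtain ⟨G, -, hG2, -⟩ := exists_finset_spanning_card_le_pow (Y := FKPO T 1 1 1) n ht
  obtain ⟨F, hF, -⟩ := exists_spanning_sum_le (f := fun _ => (0 : ℝ)) (η := 0) (by simp)
    one_pos one_pos le_rfl hG2
  rw [show 2 * (2 * (ε / 4)) = ε by ring] at hF
  exact ⟨F, hF⟩

theorem exp_le_spanPress [MetricSpace X] [CompactSpace X] [Nonempty X] (T : X → X)
    {f : X → ℝ} {A : ℝ} (hA : ∀ x, |f x| ≤ A) (n : ℕ) {ε : ℝ} (hε : 0 < ε) :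
    Real.exp (-(n * A)) ≤ spanPress T f n ε := by
  obtain ⟨F, hF⟩ := exists_finset_spanning T n hε
  refine le_csInf ⟨_, F, hF, rfl⟩ ?_
  rintro r ⟨F', hF', rfl⟩
  obtain ⟨y, hy, -⟩ := hF' (Classical.arbitrary X)
  exact exp_le_sum_exp ⟨y, hy⟩ fun y => abs_sum_range_le hA n (fun i => T^[i] y)

theorem exp_le_FKPOsp [MetricSpace X] [CompactSpace X] [Nonempty X] (T : X → X)
    {f : X → ℝ} {A : ℝ} (hA : ∀ x, |f x| ≤ A) (n : ℕ) {N : ℕ} {ε α δ : ℝ} (hε : 0 < ε)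
    (hα : 0 < α) (hδ : 0 < δ) (hN : 1 ≤ N) :
    Real.exp (-(n * A)) ≤ FKPOsp T f n ε α δ N := by
  obtain ⟨t, ht⟩ := exists_finset_dist_lt (X := X) (half_pos hε)
  obtain ⟨G, hG1, hG2, -⟩ := exists_finset_spanning_card_le_pow (Y := FKPO T α δ N) n ht
  rw [mul_div_cancel₀ _ two_ne_zero] at hG2
  refine le_csInf ⟨_, G, hG1, hG2, rfl⟩ ?_
  rintro r ⟨F, -, hF, rfl⟩
  obtain ⟨y, hy, -⟩ := hF _ (orbit_mem_FKPO T hα hδ hN (Classical.arbitrary X))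
  exact exp_le_sum_exp ⟨y, hy⟩ fun y => abs_sum_range_le hA n y

theorem neg_le_log_div {A a : ℝ} {n : ℕ} (hA : 0 ≤ A) (h : Real.exp (-(n * A)) ≤ a) :
    -A ≤ Real.log a / n := by
  have h1 := (Real.le_log_iff_exp_le ((Real.exp_pos _).trans_le h)).2 h
  rcases n.eq_zero_or_pos with rfl | hn
  · simpa using hA
  · rw [le_div_iff₀ (by exact_mod_cast hn)]
    linarith

theorem div_natCast_le_of_le_mul {C a : ℝ} {n : ℕ} (hC : 0 ≤ C) (h : a ≤ n * C) : a / n ≤ C :=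
  div_le_of_le_mul₀ n.cast_nonneg hC (by linarith)

/-- The exponential growth rate of the spanning sums at scale `ε`. -/
noncomputable def presAt [MetricSpace X] (T : X → X) (f : X → ℝ) (ε : ℝ) : ℝ :=
  limsup (fun n : ℕ => Real.log (spanPress T f n ε) / n) atTop

/-- The exponential growth rate of the spanning sums of pseudo-orbits at scale `ε`. -/
noncomputable def presFKPOAt [MetricSpace X] (T : X → X) (f : X → ℝ) (ε α δ : ℝ) (N : ℕ) : ℝ :=
  limsup (fun n : ℕ => Real.log (FKPOsp T f n ε α δ N) / n) atTop

/-- The infimum over `α` of the growth rates `presFKPOAt T f ε α δ N`. -/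
noncomputable def presFKPOInf [MetricSpace X] (T : X → X) (f : X → ℝ) (ε δ : ℝ) (N : ℕ) : ℝ :=
  sInf { r : ℝ | ∃ α : ℝ, 0 < α ∧ r = presFKPOAt T f ε α δ N }

section

variable [MetricSpace X] [CompactSpace X] [Nonempty X] {T : X → X} {f : X → ℝ} {A : ℝ}

theorem exists_log_FKPOsp_div_le (hA : ∀ x, |f x| ≤ A) {ε : ℝ} (hε : 0 < ε) :
    ∃ C, ∀ (α δ : ℝ) (N n : ℕ), 0 < α → 0 < δ → 1 ≤ N →
      Real.log (FKPOsp T f n ε α δ N) / n ≤ C := by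
  have hA0 : 0 ≤ A := (abs_nonneg _).trans (hA (Classical.arbitrary X))
  obtain ⟨t, ht⟩ := exists_finset_dist_lt (X := X) (half_pos hε)
  obtain ⟨y, hy, -⟩ := ht (Classical.arbitrary X)
  have hc : (1 : ℝ) ≤ t.card := by exact_mod_cast Finset.card_pos.2 ⟨y, hy⟩
  refine ⟨Real.log t.card + A, fun α δ N n hα hδ hN =>
    div_natCast_le_of_le_mul (add_nonneg (Real.log_nonneg hc) hA0) ?_⟩
  obtain ⟨G, hG1, hG2, hG3⟩ := exists_finset_spanning_card_le_pow (Y := FKPO T α δ N) n ht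
  rw [mul_div_cancel₀ _ two_ne_zero] at hG2
  have h1 := FKPOsp_le_card_mul_exp hA hG1 hG2
  have h2 : (G.card : ℝ) ≤ (t.card : ℝ) ^ n := by exact_mod_cast hG3
  have h3 : FKPOsp T f n ε α δ N ≤ (t.card : ℝ) ^ n * Real.exp (n * A) :=
    h1.trans (by gcongr)
  have hpos := (Real.exp_pos _).trans_le (exp_le_FKPOsp T hA n hε hα hδ hN)
  refine (Real.log_le_log hpos h3).trans_eq ?_
  rw [Real.log_mul (by positivity) (Real.exp_pos _).ne', Real.log_pow, Real.log_exp]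
  ring

theorem isBoundedUnder_log_FKPOsp (hA : ∀ x, |f x| ≤ A) {ε α δ : ℝ} {N : ℕ} (hε : 0 < ε)
    (hα : 0 < α) (hδ : 0 < δ) (hN : 1 ≤ N) :
    IsBoundedUnder (· ≤ ·) atTop (fun n : ℕ => Real.log (FKPOsp T f n ε α δ N) / n) := by
  obtain ⟨C, hC⟩ := exists_log_FKPOsp_div_le (T := T) hA hε
  exact isBoundedUnder_of ⟨C, fun n => hC α δ N n hα hδ hN⟩

theorem neg_le_log_FKPOsp_div (hA : ∀ x, |f x| ≤ A) {ε α δ : ℝ} {N : ℕ} (hε : 0 < ε)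
    (hα : 0 < α) (hδ : 0 < δ) (hN : 1 ≤ N) (n : ℕ) :
    -A ≤ Real.log (FKPOsp T f n ε α δ N) / n :=
  neg_le_log_div ((abs_nonneg _).trans (hA (Classical.arbitrary X)))
    (exp_le_FKPOsp T hA n hε hα hδ hN)

theorem neg_le_log_spanPress_div (hA : ∀ x, |f x| ≤ A) {ε : ℝ} (hε : 0 < ε) (n : ℕ) :
    -A ≤ Real.log (spanPress T f n ε) / n :=
  neg_le_log_div ((abs_nonneg _).trans (hA (Classical.arbitrary X)))
    (exp_le_spanPress T hA n hε)

theorem isCoboundedUnder_of_forall_ge {ι : Type*} {l : Filter ι} [l.NeBot] {u : ι → ℝ} {a : ℝ}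
    (h : ∀ᶠ n in l, a ≤ u n) : IsCoboundedUnder (· ≤ ·) l u :=
  IsBoundedUnder.isCoboundedUnder_le ⟨a, by simpa using h⟩

theorem log_spanPress_div_le (hA : ∀ x, |f x| ≤ A) {ε η α δ : ℝ} {N : ℕ} (hε : 0 < ε)
    (hη0 : 0 ≤ η) (hη : ∀ u v, dist u v < ε → |f u - f v| ≤ η)
    (hα : 0 < α) (hδ : 0 < δ) (hN : 1 ≤ N) (n : ℕ) :
    Real.log (spanPress T f n (2 * ε)) / n ≤ Real.log (FKPOsp T f n ε α δ N) / n + η := by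
  rcases n.eq_zero_or_pos with rfl | hn
  · simpa using hη0
  have hn' : (0 : ℝ) < n := by exact_mod_cast hn
  have h1 := (Real.exp_pos _).trans_le
    (exp_le_spanPress T hA n (show 0 < 2 * ε by positivity))
  have h2 := (Real.exp_pos _).trans_le (exp_le_FKPOsp T hA n hε hα hδ hN)
  have h := Real.log_le_log h1 (spanPress_le_mul_FKPOsp hε hη hα hδ hN)
  rw [Real.log_mul (Real.exp_pos _).ne' h2.ne', Real.log_exp] at h
  rw [div_add' _ _ _ hn'.ne', div_le_div_iff_of_pos_right hn']
  linarith

theorem isBoundedUnder_log_spanPress (hA : ∀ x, |f x| ≤ A) {ε : ℝ} (hε : 0 < ε) :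
    IsBoundedUnder (· ≤ ·) atTop (fun n : ℕ => Real.log (spanPress T f n ε) / n) := by
  have hA0 : 0 ≤ A := (abs_nonneg _).trans (hA (Classical.arbitrary X))
  obtain ⟨C, hC⟩ := exists_log_FKPOsp_div_le (T := T) hA (half_pos hε)
  refine isBoundedUnder_of ⟨C + 2 * A, fun n => ?_⟩
  have h := log_spanPress_div_le (T := T) hA (half_pos hε) (η := 2 * A) (by positivity)
    (fun u v _ => (abs_sub _ _).trans (by linarith [hA u, hA v])) one_pos one_pos le_rfl n
  rw [mul_div_cancel₀ _ two_ne_zero] at h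
  linarith [hC 1 1 1 n one_pos one_pos le_rfl]

theorem neg_le_presFKPOAt (hA : ∀ x, |f x| ≤ A) {ε α δ : ℝ} {N : ℕ} (hε : 0 < ε)
    (hα : 0 < α) (hδ : 0 < δ) (hN : 1 ≤ N) : -A ≤ presFKPOAt T f ε α δ N :=
  le_limsup_of_frequently_le
    (Eventually.of_forall (neg_le_log_FKPOsp_div hA hε hα hδ hN)).frequently
    (isBoundedUnder_log_FKPOsp hA hε hα hδ hN)

theorem neg_le_presAt (hA : ∀ x, |f x| ≤ A) {ε : ℝ} (hε : 0 < ε) : -A ≤ presAt T f ε :=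
  le_limsup_of_frequently_le
    (Eventually.of_forall (neg_le_log_spanPress_div hA hε)).frequently
    (isBoundedUnder_log_spanPress hA hε)

theorem presFKPOInf_le (hA : ∀ x, |f x| ≤ A) {ε α δ : ℝ} {N : ℕ} (hε : 0 < ε)
    (hα : 0 < α) (hδ : 0 < δ) (hN : 1 ≤ N) :
    presFKPOInf T f ε δ N ≤ presFKPOAt T f ε α δ N := by
  refine csInf_le ⟨-A, ?_⟩ ⟨α, hα, rfl⟩
  rintro r ⟨α', hα', rfl⟩
  exact neg_le_presFKPOAt hA hε hα' hδ hN

theorem neg_le_presFKPOInf (hA : ∀ x, |f x| ≤ A) {ε δ : ℝ} {N : ℕ} (hε : 0 < ε)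
    (hδ : 0 < δ) (hN : 1 ≤ N) : -A ≤ presFKPOInf T f ε δ N := by
  refine le_csInf ⟨_, 1, one_pos, rfl⟩ ?_
  rintro r ⟨α, hα, rfl⟩
  exact neg_le_presFKPOAt hA hε hα hδ hN

theorem presAt_le_presFKPOInf (hA : ∀ x, |f x| ≤ A) {ε η δ : ℝ} {N : ℕ} (hε : 0 < ε)
    (hη0 : 0 ≤ η) (hη : ∀ u v, dist u v < ε → |f u - f v| ≤ η) (hδ : 0 < δ) (hN : 1 ≤ N) :
    presAt T f (2 * ε) ≤ presFKPOInf T f ε δ N + η := by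
  rw [← sub_le_iff_le_add]
  refine le_csInf ⟨_, 1, one_pos, rfl⟩ ?_
  rintro r ⟨α, hα, rfl⟩
  rw [sub_le_iff_le_add]
  refine le_of_forall_pos_le_add fun ζ hζ => ?_
  refine limsup_le_of_le (isCoboundedUnder_of_forall_ge
    (Eventually.of_forall (neg_le_log_spanPress_div hA (by positivity)))) ?_
  have h := eventually_lt_of_limsup_lt
    (show presFKPOAt T f ε α δ N < presFKPOAt T f ε α δ N + ζ by linarith)
    (isBoundedUnder_log_FKPOsp hA hε hα hδ hN)
  filter_upwards [h] with n hn
  linarith [log_spanPress_div_le hA hε hη0 hη hα hδ hN n (T := T)]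

theorem presAt_le_limsup_presFKPOInf (hA : ∀ x, |f x| ≤ A) {ε η : ℝ} {N : ℝ → ℕ} (hε : 0 < ε)
    (hη0 : 0 ≤ η) (hη : ∀ u v, dist u v < ε → |f u - f v| ≤ η) (hN : ∀ δ, 0 < δ → 1 ≤ N δ) :
    presAt T f (2 * ε) ≤ limsup (fun δ => presFKPOInf T f ε δ (N δ)) (𝓝[>] 0) + η := by
  rw [← sub_le_iff_le_add]
  obtain ⟨C, hC⟩ := exists_log_FKPOsp_div_le (T := T) hA hε
  refine le_limsup_of_frequently_le (Eventually.frequently ?_) ⟨C, ?_⟩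
  · filter_upwards [self_mem_nhdsWithin] with δ hδ
    rw [sub_le_iff_le_add]
    exact presAt_le_presFKPOInf hA hε hη0 hη hδ (hN δ hδ)
  · rw [eventually_map]
    filter_upwards [self_mem_nhdsWithin] with δ hδ
    refine (presFKPOInf_le hA hε one_pos hδ (hN δ hδ)).trans ?_
    exact limsup_le_of_le (isCoboundedUnder_of_forall_ge
      (Eventually.of_forall (neg_le_log_FKPOsp_div hA hε one_pos hδ (hN δ hδ))))
      (Eventually.of_forall fun n => hC 1 δ (N δ) n one_pos hδ (hN δ hδ))

theorem exists_spanning_log_card_le (hA : ∀ x, |f x| ≤ A) {ε B : ℝ} (hε : 0 < ε)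
    (hB : presAt T f ε ≤ B) :
    ∃ M > 0, ∃ F : Finset X, (∀ x : X, ∃ y ∈ F, ∀ i < M, dist (T^[i] x) (T^[i] y) ≤ ε) ∧
      Real.log F.card ≤ M * (B + 1 + A) := by
  have h := eventually_lt_of_limsup_lt (show presAt T f ε < B + 1 by linarith)
    (isBoundedUnder_log_spanPress hA hε)
  obtain ⟨M, hM, hM0⟩ := (h.and (eventually_gt_atTop 0)).exists
  have hM0' : (0 : ℝ) < M := by exact_mod_cast hM0
  refine ⟨M, hM0, ?_⟩
  have hpos := (Real.exp_pos _).trans_le (exp_le_spanPress T hA M hε)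
  rw [div_lt_iff₀ hM0', Real.log_lt_iff_lt_exp hpos, spanPress] at hM
  obtain ⟨F₀, hF₀⟩ := exists_finset_spanning T M hε
  obtain ⟨_, ⟨F, hF, rfl⟩, hlt⟩ := exists_lt_of_csInf_lt (by exact ⟨_, F₀, hF₀, rfl⟩) hM
  refine ⟨F, hF, ?_⟩
  obtain ⟨y, hy, -⟩ := hF (Classical.arbitrary X)
  have hc : (0 : ℝ) < F.card := by exact_mod_cast Finset.card_pos.2 ⟨y, hy⟩
  have h1 : F.card • Real.exp (-(M * A)) ≤
      ∑ y ∈ F, Real.exp (∑ i ∈ Finset.range M, f (T^[i] y)) :=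
    Finset.card_nsmul_le_sum _ _ _ fun y _ =>
      Real.exp_le_exp.2 (abs_le.1 (abs_sum_range_le hA M (fun i => T^[i] y))).1
  rw [nsmul_eq_mul] at h1
  have h2 := Real.log_le_log (by positivity) (h1.trans hlt.le)
  rw [Real.log_mul hc.ne' (Real.exp_pos _).ne', Real.log_exp, Real.log_exp] at h2
  linarith

theorem presFKPOInf_le_of_presAt_le (hT : Continuous T) (hA : ∀ x, |f x| ≤ A) {ε B : ℝ}
    (hε : 0 < ε) (hB : presAt T f ε ≤ B) :
    ∀ᶠ δ in 𝓝[>] (0 : ℝ), ∀ N : ℕ, 1 ≤ N →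
      presFKPOInf T f (5 * ε) δ N ≤ B + 2 * A + 2 * Real.log 2 + 3 := by
  obtain ⟨M, hM, F, hF, hFcard⟩ := exists_spanning_log_card_le hA hε hB
  obtain ⟨t, ht⟩ := exists_finset_dist_lt (X := X) hε
  obtain ⟨α, hα, hshadow⟩ := exists_shadow_const hT M hε
  have hF0 : (1 : ℝ) ≤ F.card := by
    obtain ⟨y, hy, -⟩ := hF (Classical.arbitrary X)
    exact_mod_cast Finset.card_pos.2 ⟨y, hy⟩
  have ht0 : (1 : ℝ) ≤ t.card := by
    obtain ⟨y, hy, -⟩ := ht (Classical.arbitrary X)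
    exact_mod_cast Finset.card_pos.2 ⟨y, hy⟩
  have hlt := Real.log_nonneg ht0
  have hlF := Real.log_nonneg hF0
  have hM' : (0 : ℝ) < M := by exact_mod_cast hM
  have hC0 : 0 ≤ B + 1 + A := nonneg_of_mul_nonneg_right (hlF.trans hFcard) hM'
  have hsmall : ∀ᶠ δ in 𝓝[>] (0 : ℝ), δ * Real.log t.card ≤ 1 := by
    have : Tendsto (fun δ : ℝ => δ * Real.log t.card) (𝓝[>] 0) (𝓝 0) := by
      have := ((continuous_id.mul continuous_const).tendsto' (0 : ℝ) (0 : ℝ)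
        (by simp) : Tendsto (fun δ : ℝ => id δ * Real.log t.card) (𝓝 0) (𝓝 0))
      exact this.mono_left nhdsWithin_le_nhds
    exact this.eventually (ge_mem_nhds one_pos)
  filter_upwards [hsmall, self_mem_nhdsWithin] with δ hδ1 hδ N hN
  rw [mem_Ioi] at hδ
  refine (presFKPOInf_le hA (by positivity) hα hδ hN).trans ?_
  refine limsup_le_of_le (isCoboundedUnder_of_forall_ge (Eventually.of_forall
    (neg_le_log_FKPOsp_div hA (by positivity) hα hδ hN))) ?_
  obtain ⟨K, hK⟩ := exists_nat_ge (Real.log (N + 1) + 2 * N * Real.log 2 +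
    (N + 1) * Real.log t.card + N + (B + 1 + A) * (N + M))
  filter_upwards [eventually_gt_atTop N, eventually_ge_atTop K] with n hn hnK
  obtain ⟨G, hG1, hG2, hG3⟩ := exists_finset_spanning_FKPO_card_le hε hα.le hδ.le hM hn ht hF
    hshadow
  have h1 := FKPOsp_le_card_mul_exp hA hG1 hG2
  have h2 : (G.card : ℝ) ≤ (N + 1) * (2 ^ (n + N) * (2 ^ (n + N) *
      ((t.card : ℝ) ^ (N + ⌊δ * (n + N : ℕ)⌋₊ + 1) * (F.card : ℝ) ^ ((n + N) / M + 1)))) := by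
    exact_mod_cast hG3
  have hpos := (Real.exp_pos _).trans_le
    (exp_le_FKPOsp T hA n (show 0 < 5 * ε by positivity) hα hδ hN)
  have h3 := Real.log_le_log hpos (h1.trans (mul_le_mul_of_nonneg_right h2 (Real.exp_pos _).le))
  have ht1 : (t.card : ℝ) ≠ 0 := by positivity
  have hF1 : (F.card : ℝ) ≠ 0 := by positivity
  rw [Real.log_mul (by positivity) (by positivity), Real.log_mul (by positivity) (by positivity),
    Real.log_mul (by positivity) (by positivity), Real.log_mul (by positivity) (by positivity),
    Real.log_mul (by positivity) (by positivity), Real.log_pow, Real.log_pow, Real.log_pow,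
    Real.log_exp] at h3
  push_cast at h3
  have hfloor : (⌊δ * ((n : ℝ) + N)⌋₊ : ℝ) ≤ δ * (n + N) := Nat.floor_le (by positivity)
  have hdiv : (((n + N) / M : ℕ) : ℝ) * M ≤ n + N := by
    exact_mod_cast Nat.div_mul_le_self (n + N) M
  have h4 : (⌊δ * ((n : ℝ) + N)⌋₊ : ℝ) * Real.log t.card ≤ n + N := by
    calc _ ≤ δ * (n + N) * Real.log t.card := by gcongr
      _ = δ * Real.log t.card * (n + N) := by ring
      _ ≤ 1 * (n + N) := by gcongr
      _ = _ := one_mul _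
  have h5 : ((((n + N) / M : ℕ) : ℝ) + 1) * Real.log F.card ≤ (B + 1 + A) * (n + N + M) := by
    calc _ ≤ ((((n + N) / M : ℕ) : ℝ) + 1) * (M * (B + 1 + A)) := by gcongr
      _ = ((((n + N) / M : ℕ) : ℝ) * M + M) * (B + 1 + A) := by ring
      _ ≤ ((n + N) + M) * (B + 1 + A) := by gcongr
      _ = _ := by ring
  have hnK' : (K : ℝ) ≤ n := by exact_mod_cast hnK
  have hn0 : (0 : ℝ) < n := by exact_mod_cast (Nat.zero_le N).trans_lt hn
  rw [div_le_iff₀ hn0]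
  linarith

theorem limsup_presFKPOInf_le_of_presAt_le (hT : Continuous T) (hA : ∀ x, |f x| ≤ A) {ε B : ℝ}
    {N : ℝ → ℕ} (hN : ∀ δ, 0 < δ → 1 ≤ N δ) (hε : 0 < ε) (hB : presAt T f ε ≤ B) :
    limsup (fun δ => presFKPOInf T f (5 * ε) δ (N δ)) (𝓝[>] 0) ≤
      B + 2 * A + 2 * Real.log 2 + 3 := by
  refine limsup_le_of_le (isCoboundedUnder_of_forall_ge (a := -A) ?_) ?_
  · filter_upwards [self_mem_nhdsWithin] with δ hδ
    exact neg_le_presFKPOInf hA (by positivity) hδ (hN δ hδ)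
  · filter_upwards [presFKPOInf_le_of_presAt_le hT hA hε hB, self_mem_nhdsWithin] with δ h hδ
    exact h _ (hN δ hδ)

end

theorem tendsto_div_const_nhdsGT_zero {c : ℝ} (hc : 0 < c) :
    Tendsto (fun ε : ℝ => ε / c) (𝓝[>] 0) (𝓝[>] 0) := by
  refine tendsto_nhdsWithin_iff.2 ⟨?_, ?_⟩
  · exact ((continuous_id.div_const c).tendsto' 0 0 (by simp)).mono_left nhdsWithin_le_nhds
  · filter_upwards [self_mem_nhdsWithin] with ε hε
    exact div_pos hε hc

theorem pressure_eq_zero_of_isEmpty [MetricSpace X] [IsEmpty X] (T : X → X) (f : X → ℝ)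
    (N : ℝ → ℕ) : Pres T f = 0 ∧ PFKPO T f N = 0 := by
  have h1 : ∀ n ε, spanPress T f n ε = 0 := fun n ε => by
    have : { r : ℝ | ∃ F : Finset X,
        (∀ x : X, ∃ y ∈ F, ∀ i < n, dist (T^[i] x) (T^[i] y) ≤ ε) ∧
        r = ∑ y ∈ F, Real.exp (∑ i ∈ Finset.range n, f (T^[i] y)) } ⊆ {0} := by
      rintro r ⟨F, -, rfl⟩
      simp [Finset.eq_empty_of_isEmpty F]
    rcases subset_singleton_iff_eq.1 this with h | h <;> rw [spanPress, h] <;> simp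
  have h2 : ∀ n ε α δ N, FKPOsp T f n ε α δ N = 0 := fun n ε α δ N => by
    have : { r : ℝ | ∃ F : Finset (ℕ → X), ↑F ⊆ FKPO T α δ N ∧
        (∀ x ∈ FKPO T α δ N, ∃ y ∈ F, ∀ i < n, dist (x i) (y i) < ε) ∧
        r = ∑ y ∈ F, Real.exp (∑ i ∈ Finset.range n, f (y i)) } ⊆ {0} := by
      rintro r ⟨F, -, -, rfl⟩
      simp [Finset.eq_empty_of_isEmpty F]
    rcases subset_singleton_iff_eq.1 this with h | h <;> rw [FKPOsp, h] <;> simp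
  have h3 : ∃ α : ℝ, 0 < α := ⟨1, one_pos⟩
  simp [Pres, PFKPO, h1, h2, h3]

/-- the classical topological pressure is bounded above by the pressure
with respect to Feldman-Katok pseudo-orbits. -/
theorem pressure_le_PFKPO [MetricSpace X] [CompactSpace X] (T : X → X)
    (hT : Continuous T) (f : X → ℝ) (hf : Continuous f)
    (N : ℝ → ℕ) (hN : ∀ δ : ℝ, 0 < δ → 1 ≤ N δ) :
    Pres T f ≤ PFKPO T f N := by
  rcases isEmpty_or_nonempty X with hX | hX
  · rw [(pressure_eq_zero_of_isEmpty T f N).1, (pressure_eq_zero_of_isEmpty T f N).2]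
  obtain ⟨A, hA⟩ : ∃ A, ∀ x, |f x| ≤ A := by
    obtain ⟨A, hA⟩ := isCompact_univ.exists_bound_of_continuousOn hf.continuousOn
    exact ⟨A, fun x => hA x (mem_univ x)⟩
  set Q : ℝ → ℝ := fun ε => limsup (fun δ => presFKPOInf T f ε δ (N δ)) (𝓝[>] 0) with hQ
  have hP : Pres T f = limsup (presAt T f) (𝓝[>] 0) := rfl
  have hPF : PFKPO T f N = limsup Q (𝓝[>] 0) := rfl
  have key : ∀ b, (∀ᶠ ε in 𝓝[>] (0 : ℝ), Q ε ≤ b) → ∀ η > 0,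
      ∀ᶠ ε in 𝓝[>] (0 : ℝ), presAt T f ε ≤ b + η := by
    intro b hb η hη
    obtain ⟨ε₀, hε₀, hfε⟩ := Metric.uniformContinuous_iff.1
      (CompactSpace.uniformContinuous_of_continuous hf) η hη
    have hsmall : ∀ᶠ ε in 𝓝[>] (0 : ℝ), ε ≤ ε₀ :=
      nhdsWithin_le_nhds (ge_mem_nhds hε₀)
    filter_upwards [(tendsto_div_const_nhdsGT_zero two_pos).eventually
      ((hb.and hsmall).and self_mem_nhdsWithin)] with ε hε
    obtain ⟨⟨h1, h2⟩, h3⟩ := hε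
    have h := presAt_le_limsup_presFKPOInf (T := T) hA h3 hη.le
      (fun u v huv => (hfε (huv.trans_le h2)).le) hN
    rw [mul_div_cancel₀ _ two_ne_zero] at h
    exact h.trans (by linarith)
  rw [hP, hPF]
  by_cases hB : ∃ B, ∀ᶠ ε in 𝓝[>] (0 : ℝ), presAt T f ε ≤ B
  · obtain ⟨B, hB⟩ := hB
    refine le_limsup_of_le ⟨B + 2 * A + 2 * Real.log 2 + 3, ?_⟩ fun b hb => ?_
    · rw [eventually_map]
      filter_upwards [(tendsto_div_const_nhdsGT_zero (show (0 : ℝ) < 5 by norm_num)).eventually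
        (hB.and self_mem_nhdsWithin)] with ε hε
      have h := limsup_presFKPOInf_le_of_presAt_le hT hA hN hε.2 hε.1
      rwa [mul_div_cancel₀ _ (by norm_num)] at h
    · refine le_of_forall_pos_le_add fun η hη =>
        limsup_le_of_le (isCoboundedUnder_of_forall_ge (a := -A) ?_) (key b hb η hη)
      filter_upwards [self_mem_nhdsWithin] with ε hε
      exact neg_le_presAt hA hε
  · have hQB : ¬ ∃ b, ∀ᶠ ε in 𝓝[>] (0 : ℝ), Q ε ≤ b := fun ⟨b, hb⟩ =>
      hB ⟨b + 1, key b hb 1 one_pos⟩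
    have hempty : ∀ u : ℝ → ℝ, (¬ ∃ b, ∀ᶠ ε in 𝓝[>] (0 : ℝ), u ε ≤ b) →
        limsup u (𝓝[>] 0) = 0 := fun u hu => by
      have : {b | ∀ᶠ ε in 𝓝[>] (0 : ℝ), u ε ≤ b} = ∅ :=
        eq_empty_of_forall_notMem fun b hb => hu ⟨b, hb⟩
      rw [limsup_eq, this, Real.sInf_empty]
    rw [hempty _ hB, hempty _ hQB]
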